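/- Let 𝔤 be a real Lie algebra equipped with an invariant inner product ⟨·,·⟩ (i.e. ⟨[a,b],c⟩ + ⟨b,[a,c]⟩ = 0 for all a,b,c), let X ∈ 𝔤, and let F(y) = ⟨y,y⟩/⟨X,y⟩ be the associated Kropina norm with fundamental tensor g_Y. If Y, U ∈ 𝔤 are orthonormal (⟨Y,Y⟩ = ⟨U,U⟩ = 1, ⟨Y,U⟩ = 0), ⟨X,Y⟩ ≠ 0, and W := −(1/4)[[U,Y],Y], then g_Y(W,U)/(g_Y(Y,Y)·g_Y(U,U) − g_Y(Y,U)²) = (−3⟨X,U⟩⟨[[U,Y],Y],X⟩ − 2⟨X,Y⟩²⟨[[U,Y],Y],U⟩)/(8(⟨X,U⟩/⟨X,Y⟩)² + 8). -/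

import Mathlib

open scoped RealInnerProductSpace

/-- The Kropina norm `F(y) = ⟨y,y⟩ / ⟨X,y⟩` associated with the inner product and the
fixed vector `X`. -/
noncomputable def kropinaF {V : Type*} [NormedAddCommGroup V] [InnerProductSpace ℝ V]
    (X y : V) : ℝ :=
  ⟪y, y⟫ / ⟪X, y⟫

/-- The fundamental tensor of the Kropina norm:
`g_Y(U,W) = (1/2) ∂²/∂s∂t [F(Y+sU+tW)²]|_{s=t=0}`. -/
noncomputable def kropinaG {V : Type*} [NormedAddCommGroup V] [InnerProductSpace ℝ V]
    (X Y U W : V) : ℝ :=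
  (1 / 2) *
    deriv (fun s : ℝ => deriv (fun t : ℝ => (kropinaF X (Y + s • U + t • W)) ^ 2) 0) 0

/-- A monotone additive function on the reals is linear. -/
theorem additive_nonneg_linear (f : ℝ → ℝ) (hadd : ∀ s t, f (s + t) = f s + f t)
    (hpos : ∀ s, 0 ≤ s → 0 ≤ f s) (r : ℝ) : f r = r * f 1 := by
  let g : ℝ →+ ℝ := AddMonoidHom.mk' f hadd
  have hrat : ∀ q : ℚ, f q = q * f 1 := by
    intro q
    have h := map_ratCast_smul g ℝ ℝ q 1
    simpa [g] using h
  have hmono : ∀ s t, s ≤ t → f s ≤ f t := by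
    intro s t h
    have h1 := hadd s (t - s)
    have h2 := hpos (t - s) (by linarith)
    rw [add_sub_cancel] at h1
    linarith
  have h1 := hpos 1 zero_le_one
  rcases h1.eq_or_lt with h0 | h0
  · obtain ⟨p, hp⟩ := exists_rat_lt r
    obtain ⟨q, hq⟩ := exists_rat_gt r
    have a := hmono _ _ hp.le
    have b := hmono _ _ hq.le
    rw [hrat, ← h0] at a b
    rw [← h0]
    linarith
  · rcases lt_trichotomy (f r) (r * f 1) with h | h | h
    · rw [← div_lt_iff₀ h0] at h
      obtain ⟨q, hq, hq'⟩ := exists_rat_btwn h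
      have a := hmono _ _ hq'.le
      rw [hrat] at a
      rw [div_lt_iff₀ h0] at hq
      linarith
    · exact h
    · rw [← lt_div_iff₀ h0] at h
      obtain ⟨q, hq, hq'⟩ := exists_rat_btwn h
      have a := hmono _ _ hq.le
      rw [hrat] at a
      rw [lt_div_iff₀ h0] at hq'
      linarith

/-- If a Lie algebra structure (a priori with its own addition `ladd`, scalar action `sm` and
zero `z`) has an invariant inner product, its scalar action agrees with that of the inner
product space on brackets. -/
theorem lie_smul_eq_smul {V : Type*} [NormedAddCommGroup V] [InnerProductSpace ℝ V]
    (br ladd : V → V → V) (sm : ℝ → V → V) (z : V)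
    (hza : ∀ x, ladd z x = x) (haz : ∀ x, ladd x z = x)
    (hself : ∀ a, br a a = z) (hbz : ∀ a, br z a = z)
    (hadd : ∀ a b c, br (ladd a b) c = ladd (br a c) (br b c))
    (hs1 : ∀ r a b, br (sm r a) b = sm r (br a b))
    (hs2 : ∀ r a b, br a (sm r b) = sm r (br a b))
    (hsz : ∀ r, sm r z = z) (h1 : ∀ x, sm 1 x = x)
    (hsm : ∀ r s x, sm (r * s) x = sm r (sm s x))
    (hsa : ∀ r s x, sm (r + s) x = ladd (sm r x) (sm s x))
    (hanti : ∀ a b, br a b = sm (-1) (br b a))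
    (hinv : ∀ a b c : V, ⟪br a b, c⟫ + ⟪b, br a c⟫ = 0)
    (r : ℝ) (a b : V) : sm r (br a b) = r • br a b := by
  have hz : z = 0 := by
    have h := hinv z z z
    rw [hbz] at h
    have : ⟪z, z⟫ = 0 := by linarith
    exact inner_self_eq_zero.mp this
  have hlin : ∀ a x y, br a (x + y) = br a x + br a y := by
    intro a x y
    refine ext_inner_right ℝ fun c => ?_
    have e1 := hinv a (x + y) c
    have e2 := hinv a x c
    have e3 := hinv a y c
    rw [inner_add_left] at e1 ⊢
    linarith
  have hT : ∀ s t, sm (s + t) (br a b) = sm s (br a b) + sm t (br a b) := by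
    intro s t
    have e1 := hlin (ladd a b) (sm s b) (sm (-t) a)
    rw [hadd, hadd, hadd, hlin, hlin] at e1
    simp only [hs2, hself, hsz, hza, haz] at e1
    rw [hanti b a, ← hsm] at e1
    simp only [hz, add_zero, zero_add, mul_neg, mul_one, neg_neg] at e1
    rw [hsa, e1]
  have hsymm : ∀ r x, ⟪sm r x, br a b⟫ = ⟪x, sm r (br a b)⟫ := by
    intro r x
    have e1 := hinv a (sm r x) b
    have e2 := hinv (sm r a) x b
    rw [hs2] at e1
    rw [hs1, hs1] at e2
    linarith
  have hf : ∀ r, ⟪sm r (br a b), br a b⟫ = r * ⟪br a b, br a b⟫ := by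
    intro r
    have h := additive_nonneg_linear (fun r => ⟪sm r (br a b), br a b⟫)
      (fun s t => by simp only [hT, inner_add_left])
      (fun s hs => by
        have : s = √s * √s := (Real.mul_self_sqrt hs).symm
        rw [this, hsm, hsymm]
        exact real_inner_self_nonneg) r
    simpa only [h1] using h
  rw [← sub_eq_zero, ← inner_self_eq_zero (𝕜 := ℝ)]
  have e : ⟪sm r (br a b), sm r (br a b)⟫ = r * r * ⟪br a b, br a b⟫ := by
    rw [← hsymm, ← hsm, hf]
  simp only [inner_sub_left, inner_sub_right, real_inner_smul_left, real_inner_smul_right, e,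
    hf, real_inner_comm (sm r (br a b)) (br a b)]
  ring

/-- Closed formula for the fundamental tensor. -/
theorem kropinaG_eq {V : Type*} [NormedAddCommGroup V] [InnerProductSpace ℝ V]
    (X Y A B : V) (h : ⟪X, Y⟫ ≠ 0) :
    kropinaG X Y A B =
      (4 * ⟪Y, A⟫ * ⟪Y, B⟫ + 2 * ⟪Y, Y⟫ * ⟪A, B⟫) / ⟪X, Y⟫ ^ 2
      - 4 * ⟪Y, Y⟫ * (⟪Y, B⟫ * ⟪X, A⟫ + ⟪Y, A⟫ * ⟪X, B⟫) / ⟪X, Y⟫ ^ 3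
      + 3 * ⟪Y, Y⟫ ^ 2 * ⟪X, A⟫ * ⟪X, B⟫ / ⟪X, Y⟫ ^ 4 := by
  have hF : ∀ s t : ℝ, kropinaF X (Y + s • A + t • B) =
      (⟪Y, Y⟫ + 2 * s * ⟪Y, A⟫ + s ^ 2 * ⟪A, A⟫ + t * (2 * ⟪Y, B⟫ + 2 * s * ⟪A, B⟫)
        + t ^ 2 * ⟪B, B⟫) / (⟪X, Y⟫ + s * ⟪X, A⟫ + t * ⟪X, B⟫) := by
    intro s t
    unfold kropinaF
    simp only [inner_add_left, inner_add_right, real_inner_smul_left, real_inner_smul_right,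
      real_inner_comm Y A, real_inner_comm Y B, real_inner_comm A B]
    congr 1
    ring
  unfold kropinaG
  simp only [hF]
  generalize ⟪X, Y⟫ = b at *
  generalize ⟪X, A⟫ = u
  generalize ⟪X, B⟫ = w
  generalize ⟪Y, Y⟫ = y
  generalize ⟪Y, A⟫ = ya
  generalize ⟪Y, B⟫ = yb
  generalize ⟪A, A⟫ = aa
  generalize ⟪A, B⟫ = ab
  generalize ⟪B, B⟫ = bb
  have hid : ∀ x : ℝ, HasDerivAt (fun t : ℝ => t) 1 x := fun x => hasDerivAt_id x
  have hev : ∀ᶠ s : ℝ in nhds 0, b + s * u ≠ 0 := by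
    have : ContinuousAt (fun s : ℝ => b + s * u) 0 := by fun_prop
    exact this.eventually_ne (by simpa using h)
  have hin : (fun s : ℝ => deriv (fun t : ℝ => ((y + 2 * s * ya + s ^ 2 * aa
      + t * (2 * yb + 2 * s * ab) + t ^ 2 * bb) / (b + s * u + t * w)) ^ 2) 0) =ᶠ[nhds 0]
      fun s => (2 * (y + s * (2 * ya) + s ^ 2 * aa) * (2 * yb + s * (2 * ab)) * (b + s * u)
        - 2 * (y + s * (2 * ya) + s ^ 2 * aa) ^ 2 * w) / (b + s * u) ^ 3 := by
    filter_upwards [hev] with s hs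
    have hN := (((hid 0).mul_const (2 * yb + 2 * s * ab)).const_add
      (y + 2 * s * ya + s ^ 2 * aa)).add (((hid 0).pow 2).mul_const bb)
    have hD := ((hid 0).mul_const w).const_add (b + s * u)
    have := ((hN.div hD (by simpa using hs)).pow 2).deriv
    refine Eq.trans this ?_
    simp
    field_simp
  rw [hin.deriv_eq]
  have hN := (((hid 0).mul_const (2 * ya)).const_add y).add (((hid 0).pow 2).mul_const aa)
  have hM := ((hid 0).mul_const (2 * ab)).const_add (2 * yb)
  have hD := ((hid 0).mul_const u).const_add b
  have := (((((hN.const_mul 2).mul hM).mul hD).sub (((hN.pow 2).const_mul 2).mul_const w)).div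
    (hD.pow 3) (by simpa using h)).deriv
  refine (congrArg (fun v => (1 / 2 : ℝ) * v) (Eq.trans (congrArg (fun f => deriv f 0) ?_) this)).trans ?_
  · funext s
    simp
  · simp
    field_simp
    ring

/-- Flag curvature of a bi-invariant Kropina metric (Theorem 2.3 of the paper): for a
real Lie algebra `𝔤` with invariant inner product, orthonormal `Y, U`, `⟨X,Y⟩ ≠ 0`, and
`W = −(1/4)[[U,Y],Y]` (the curvature vector `R(U,Y)Y` of the bi-invariant metric),
`g_Y(W,U)/(g_Y(Y,Y)g_Y(U,U) − g_Y(Y,U)²)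
  = (−3⟨X,U⟩⟨[[U,Y],Y],X⟩ − 2⟨X,Y⟩²⟨[[U,Y],Y],U⟩)/(8(⟨X,U⟩/⟨X,Y⟩)² + 8)`. -/
theorem kropina_flag_curvature_biinvariant {𝔤 : Type*} [NormedAddCommGroup 𝔤]
    [InnerProductSpace ℝ 𝔤] [LieRing 𝔤] [LieAlgebra ℝ 𝔤]
    (hinv : ∀ a b c : 𝔤, ⟪⁅a, b⁆, c⟫ + ⟪b, ⁅a, c⁆⟫ = 0)
    (X Y U : 𝔤) (hY : ⟪Y, Y⟫ = 1) (hU : ⟪U, U⟫ = 1) (hYU : ⟪Y, U⟫ = 0)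
    (hXY : ⟪X, Y⟫ ≠ 0) (W : 𝔤) (hW : W = -(1 / 4 : ℝ) • ⁅⁅U, Y⁆, Y⁆) :
    kropinaG X Y W U / (kropinaG X Y Y Y * kropinaG X Y U U - (kropinaG X Y Y U) ^ 2) =
      (-3 * ⟪X, U⟫ * ⟪⁅⁅U, Y⁆, Y⁆, X⟫ - 2 * ⟪X, Y⟫ ^ 2 * ⟪⁅⁅U, Y⁆, Y⁆, U⟫) /
        (8 * (⟪X, U⟫ / ⟪X, Y⟫) ^ 2 + 8) := by
  have hself0 : ∀ a : 𝔤, ⁅a, a⁆ = (0 : 𝔤) := fun a => lie_self a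
  have key := lie_smul_eq_smul (V := 𝔤) (fun a b => ⁅a, b⁆)
    (@HAdd.hAdd 𝔤 𝔤 𝔤 (@instHAdd 𝔤 (LieRing.toAddCommGroup (L := 𝔤)).toAddGroup.toSubNegMonoid.toAddMonoid.toAdd))
    (fun r x => (LieAlgebra.toModule (R := ℝ) (L := 𝔤)).toSMul.smul r x)
    (LieRing.toAddCommGroup (L := 𝔤)).toAddGroup.toSubNegMonoid.toAddMonoid.toZero.zero
    (fun x => zero_add x) (fun x => add_zero x) (fun a => lie_self a) (fun a => zero_lie a)
    (fun a b c => add_lie a b c) (fun r a b => smul_lie r a b) (fun r a b => lie_smul r a b)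
    (fun r => smul_zero r) (fun x => one_smul ℝ x) (fun r s x => mul_smul r s x)
    (fun r s x => add_smul r s x)
    (fun a b => by
      refine (lie_skew a b).symm.trans ?_
      exact (neg_one_smul ℝ ⁅b, a⁆).symm)
    hinv (-(1 / 4 : ℝ)) ⁅U, Y⁆ Y
  have hW' := hW.trans key
  have hZ : ⟪⁅⁅U, Y⁆, Y⁆, Y⟫ = 0 := by
    have e := hinv ⁅U, Y⁆ Y Y
    rw [real_inner_comm] at e
    rw [real_inner_comm]
    linarith
  clear hW key hself0
  generalize ⁅⁅U, Y⁆, Y⁆ = Z at *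
  have w1 : ⟪W, U⟫ = -(1 / 4) * ⟪Z, U⟫ := by rw [hW']; exact real_inner_smul_left _ _ _
  have w2 : ⟪X, W⟫ = -(1 / 4) * ⟪Z, X⟫ := by
    rw [hW', real_inner_comm X Z]; exact real_inner_smul_right _ _ _
  have w3 : ⟪Y, W⟫ = 0 := by
    rw [real_inner_comm, hW']
    refine (real_inner_smul_left _ _ _).trans ?_
    rw [hZ, mul_zero]
  simp only [kropinaG_eq X Y _ _ hXY, w1, w2, w3, hY, hU, hYU]
  generalize ⟪X, Y⟫ = b at *
  generalize ⟪X, U⟫ = u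
  generalize ⟪Z, X⟫ = p
  generalize ⟪Z, U⟫ = q
  have hpos : b ^ 2 + u ^ 2 ≠ 0 := by positivity
  have hpos' : 8 * (u / b) ^ 2 + 8 ≠ 0 := by positivity
  have hden : ((4 * 1 * 1 + 2 * 1 * 1) / b ^ 2 - 4 * 1 * (1 * b + 1 * b) / b ^ 3 + 3 * 1 ^ 2 * b * b / b ^ 4) *
        ((4 * 0 * 0 + 2 * 1 * 1) / b ^ 2 - 4 * 1 * (0 * u + 0 * u) / b ^ 3 + 3 * 1 ^ 2 * u * u / b ^ 4) -
      ((4 * 1 * 0 + 2 * 1 * 0) / b ^ 2 - 4 * 1 * (0 * b + 1 * u) / b ^ 3 + 3 * 1 ^ 2 * b * u / b ^ 4) ^ 2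
      = 2 * (b ^ 2 + u ^ 2) / b ^ 6 := by
    field_simp
    ring
  rw [hden]
  have hd2 : 8 * (u / b) ^ 2 + 8 = 8 * (b ^ 2 + u ^ 2) / b ^ 2 := by
    field_simp
    ring
  rw [hd2]
  field_simp
  ring
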